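/- Let r ≥ 2 be an integer, let d ≥ 0 be an integer, and let G be a graph. Suppose that some maximum r-cut Π = {V_1, …, V_r} of G and some vertex v ∈ V_1 satisfy deg_G(v, V_1) ≥ deg_G(v)/r − ((r−1)/r)·d, where deg_G(v, W) denotes the number of neighbours of v in W and deg_G(v) the degree of v in G. Then v is not (d,r)-equivalent to any other vertex of G. -/

import Mathlib

open scoped Classical

noncomputable section

/-- The possible edges of a graph on vertex set `Fin n`. -/
abbrev EdgeType (n : ℕ) := {e : Sym2 (Fin n) // ¬ e.IsDiag}

/-- A graph on vertex set `Fin n`, identified with its edge set. -/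
abbrev FinGraph (n : ℕ) := Finset (EdgeType n)

/-- The size of the `r`-cut given by `φ` in `G`. -/
def cutSize {n r : ℕ} (φ : Fin n → Fin r) (G : FinGraph n) : ℕ :=
  (G.filter fun e => ¬ (Sym2.map φ (e : Sym2 (Fin n))).IsDiag).card

/-- The maximum size of an `r`-cut of `G`. -/
def maxCut (n r : ℕ) (G : FinGraph n) : ℕ :=
  Finset.univ.sup fun φ : Fin n → Fin r => cutSize φ G

/-- The deficit of the `r`-cut `φ` in `G`. -/
def deficit {n : ℕ} (r : ℕ) (φ : Fin n → Fin r) (G : FinGraph n) : ℕ :=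
  maxCut n r G - cutSize φ G

/-- `u` and `v` are `(d,r)`-equivalent in `G`. -/
def EqvV {n : ℕ} (d r : ℕ) (G : FinGraph n) (u v : Fin n) : Prop :=
  ∀ φ : Fin n → Fin r, deficit r φ G ≤ d → φ u = φ v

/-- `u` and `v` are adjacent in `G`. -/
def adjacent {n : ℕ} (G : FinGraph n) (u v : Fin n) : Prop :=
  ∃ e ∈ G, (e : Sym2 (Fin n)) = s(u, v)

/-- The number of neighbours of `v` in `W`. -/
def degIn {n : ℕ} (G : FinGraph n) (v : Fin n) (W : Finset (Fin n)) : ℕ :=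
  (W.filter fun u => adjacent G u v).card

/-- The degree of `v` in `G`. -/
def deg {n : ℕ} (G : FinGraph n) (v : Fin n) : ℕ := degIn G v Finset.univ

/-- The size of a cut, as a number of elements of the edge type. -/
theorem cutSize_eq_card_filter {n r : ℕ} (φ : Fin n → Fin r) (G : FinGraph n) :
    cutSize φ G =
      (G.filter fun e : EdgeType n => ¬ (Sym2.map φ (e : Sym2 (Fin n))).IsDiag).card := by
  rw [cutSize, ← Finset.card_map (Function.Embedding.subtype _)]
  congr 1
  ext e
  simp only [Finset.mem_filter, Finset.mem_map, Finset.bind_def, Finset.pure_def,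
    Finset.mem_sup, Finset.mem_singleton, Function.Embedding.subtype_apply]
  constructor
  · rintro ⟨⟨a, ha, rfl⟩, he⟩
    exact ⟨a, ⟨ha, he⟩, rfl⟩
  · rintro ⟨a, ⟨ha, he⟩, rfl⟩
    exact ⟨⟨a, ha, rfl⟩, he⟩

/-- The edges at `v` that become monochromatic when `v` is moved to part `j` correspond to the
neighbours of `v` in part `j`. -/
theorem card_monochromatic_incident {n r : ℕ} (G : FinGraph n) (φ : Fin n → Fin r) (v : Fin n)
    (j : Fin r) :
    (G.filter fun e : EdgeType n => (Sym2.map (Function.update φ v j) (e : Sym2 (Fin n))).IsDiag ∧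
      v ∈ (e : Sym2 (Fin n))).card = degIn G v (Finset.univ.filter fun u => φ u = j) := by
  unfold degIn
  rw [← Finset.card_map (Function.Embedding.subtype _),
    ← Finset.card_image_of_injective (f := fun u => s(u, v)) _
      (fun a b h => Sym2.congr_left.mp h)]
  congr 1
  ext e
  simp only [Finset.mem_map, Finset.mem_filter, Finset.mem_image, Finset.mem_univ, true_and,
    Function.Embedding.subtype_apply]
  constructor
  · rintro ⟨⟨e, he⟩, ⟨heG, hd, hv⟩, rfl⟩
    obtain ⟨u, rfl⟩ := hv
    have huv : u ≠ v := fun h => he (by simp [h])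
    refine ⟨u, ⟨?_, ⟨_, heG, Sym2.eq_swap⟩⟩, Sym2.eq_swap⟩
    simpa [huv, eq_comm] using hd
  · rintro ⟨u, ⟨hu, e, heG, he⟩, rfl⟩
    have huv : u ≠ v := fun h => e.2 (by simp [he, h])
    refine ⟨e, ⟨heG, ?_, ?_⟩, he⟩
    · simp [he, huv, hu]
    · simp [he]

/-- The size of the cut obtained by moving `v` to part `j`, plus the number of neighbours of `v`
in part `j`, does not depend on `j`. -/
theorem cutSize_update_add_degIn {n r : ℕ} (G : FinGraph n) (φ : Fin n → Fin r) (v : Fin n)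
    (j : Fin r) :
    cutSize (Function.update φ v j) G + degIn G v (Finset.univ.filter fun u => φ u = j) +
      (G.filter fun e : EdgeType n => (Sym2.map φ (e : Sym2 (Fin n))).IsDiag ∧
        v ∉ (e : Sym2 (Fin n))).card = G.card := by
  have hout : (G.filter fun e : EdgeType n => (Sym2.map φ (e : Sym2 (Fin n))).IsDiag ∧
        v ∉ (e : Sym2 (Fin n))) =
      G.filter fun e : EdgeType n => (Sym2.map (Function.update φ v j) (e : Sym2 (Fin n))).IsDiag ∧
        v ∉ (e : Sym2 (Fin n)) := by
    refine Finset.filter_congr fun e _ => and_congr_left fun hv => ?_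
    have hmap : Sym2.map φ (e : Sym2 (Fin n)) = Sym2.map (Function.update φ v j) e :=
      Sym2.map_congr fun x hx =>
        (Function.update_of_ne (ne_of_mem_of_not_mem hx hv) _ _).symm
    rw [hmap]
  rw [hout, ← card_monochromatic_incident, cutSize_eq_card_filter, add_assoc,
    ← Finset.filter_filter, ← Finset.filter_filter, Finset.card_filter_add_card_filter_not,
    add_comm, Finset.card_filter_add_card_filter_not]

/-- The degree of `v` is the sum of its degrees into the parts of a cut. -/
theorem sum_degIn_parts {n r : ℕ} (G : FinGraph n) (φ : Fin n → Fin r) (v : Fin n) :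
    ∑ j, degIn G v (Finset.univ.filter fun u => φ u = j) = deg G v := by
  simp only [deg, degIn]
  rw [Finset.card_eq_sum_card_fiberwise (f := φ) (t := Finset.univ) (by simp)]
  simp only [Finset.filter_filter, and_comm]

/-- If some maximum `r`-cut `φ` of `G` and a vertex `v` satisfy
`deg_G(v, V₁) ≥ deg_G(v)/r - ((r-1)/r) d`, where `V₁` is the part of `φ` containing `v`, then
`v` is not `(d,r)`-equivalent to any other vertex of `G`. -/
theorem not_eqv_of_large_inner_degree
    (n r d : ℕ) (hr : 2 ≤ r) (G : FinGraph n) (φ : Fin n → Fin r)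
    (hφ : cutSize φ G = maxCut n r G) (v : Fin n)
    (hdeg : (deg G v : ℝ) / r - ((r : ℝ) - 1) / r * d ≤
      (degIn G v (Finset.univ.filter fun u : Fin n => φ u = φ v) : ℝ)) :
    ∀ u : Fin n, u ≠ v → ¬ EqvV d r G v u := by
  intro u huv hE
  have h₀ : φ v = φ u := hE φ (by simp [deficit, hφ])
  obtain ⟨j, hj, hle⟩ : ∃ j ∈ Finset.univ.erase (φ v),
      degIn G v (Finset.univ.filter fun u => φ u = j) ≤
        degIn G v (Finset.univ.filter fun u => φ u = φ v) + d := by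
    refine Finset.exists_le_of_sum_le ?_ ?_
    · rw [← Finset.card_pos, Finset.card_erase_of_mem (Finset.mem_univ _), Finset.card_fin]
      omega
    · have hsum := Finset.add_sum_erase Finset.univ
        (fun j => degIn G v (Finset.univ.filter fun u => φ u = j)) (Finset.mem_univ (φ v))
      rw [sum_degIn_parts] at hsum
      rw [Finset.sum_const, Finset.card_erase_of_mem (Finset.mem_univ _), Finset.card_fin,
        smul_eq_mul]
      have hr₀ : (0 : ℝ) < r := by positivity
      have hmul : (deg G v : ℝ) - ((r : ℝ) - 1) * d ≤
          r * degIn G v (Finset.univ.filter fun u : Fin n => φ u = φ v) := by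
        have := mul_le_mul_of_nonneg_left hdeg hr₀.le
        field_simp at this
        linarith
      rw [← hsum] at hmul
      rw [← Nat.cast_le (α := ℝ)]
      push_cast [Nat.cast_sub (show 1 ≤ r by omega)] at hmul ⊢
      linarith
  have hjv : j ≠ φ v := Finset.ne_of_mem_erase hj
  have h₁ := hE (Function.update φ v j) (by
    have hnew := cutSize_update_add_degIn G φ v j
    have hold := cutSize_update_add_degIn G φ v (φ v)
    rw [Function.update_eq_self] at hold
    rw [deficit, ← hφ]
    omega)
  rw [Function.update_self, Function.update_of_ne huv] at h₁
  exact hjv (h₁.trans h₀.symm)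

end
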